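/- For every integer g ≥ 2, the quantity d₂(g) = cos²α_g + cos²β_g + cos²γ_g + 2·cos α_g·cos β_g·cos γ_g − 1 is strictly positive. -/

import Mathlib

open Real

/-- For every integer `g ≥ 2`, the quantity
`d₂(g) = cos²α_g + cos²β_g + cos²γ_g + 2 cos α_g cos β_g cos γ_g − 1`
is strictly positive. -/
theorem d2_pos (g : ℕ) (hg : 2 ≤ g) (α β γ : ℝ)
    (hα : α = π / (2 * (g : ℝ) + 2)) (hβ : β = 2 * α)
    (hγ : γ = arccos (1 / (2 * cos α))) :
    0 < cos α ^ 2 + cos β ^ 2 + cos γ ^ 2 + 2 * cos α * cos β * cos γ - 1 := by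
  have hg' : (2 : ℝ) ≤ g := by exact_mod_cast hg
  have hpi := Real.pi_pos
  have h0 : 0 ≤ α := by rw [hα]; positivity
  have h6 : α ≤ π / 6 := by
    rw [hα]
    apply div_le_div_of_nonneg_left hpi.le (by norm_num) (by linarith)
  have hc : √3 / 2 ≤ cos α := by
    rw [← Real.cos_pi_div_six]
    exact Real.cos_le_cos_of_nonneg_of_le_pi h0 (by linarith) h6
  have hs : √3 ^ 2 = 3 := Real.sq_sqrt (by norm_num)
  have hs0 : 0 < √3 := by positivity
  have hc0 : 0 < cos α := by linarith
  have hc2 : 3 / 4 ≤ cos α ^ 2 := by nlinarith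
  have hc1 : 1 ≤ 2 * cos α := by nlinarith
  have hγc : cos γ = 1 / (2 * cos α) := by
    rw [hγ]
    apply Real.cos_arccos
    · have : 0 < 1 / (2 * cos α) := by positivity
      linarith
    · rw [div_le_one (by linarith)]; exact hc1
  have hm : 2 * cos α * cos γ = 1 := by rw [hγc]; field_simp
  have hb : cos β = 2 * cos α ^ 2 - 1 := by rw [hβ, Real.cos_two_mul]
  have e : 2 * cos α * cos β * cos γ = cos β := by
    calc _ = (2 * cos α * cos γ) * cos β := by ring
      _ = _ := by rw [hm, one_mul]
  rw [e]
  nlinarith [sq_nonneg (cos γ), sq_nonneg (cos β)]
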